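/- arXiv:2111.02719 — 4 statements merged into one kernel-verified Lean document; each statement's English description precedes it below -/
import Mathlib

section
/- Every linear exchange market with limit sell offers admits an equilibrium, i.e., there exist strictly positive prices p (one positive real per asset) and fill fractions λ_i ∈ [0,1] for each offer i such that λ_i = 1 whenever p_{S_i} > α_i · p_{B_i}, λ_i = 0 whenever p_{S_i} < α_i · p_{B_i}, and for every asset A the amount of A sold equals the amount of A bought: Σ_{i : S_i = A} λ_i e_i = Σ_{i : B_i = A} λ_i e_i · p_{S_i} / p_{B_i}. -/
attribute [local instance] Classical.propDecidable

/-- A linear exchange market with limit sell offers: a finite nonempty set of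
assets and a finite family of offers; offer `i` sells asset `sell i` for a
distinct asset `buy i`, with endowment `endow i > 0` and limit price `limit i > 0`. -/
structure Market (Asset : Type) (I : Type) [Fintype Asset] [Fintype I] where
  sell : I → Asset
  buy : I → Asset
  endow : I → ℝ
  limit : I → ℝ
  distinct : ∀ i, sell i ≠ buy i
  endow_pos : ∀ i, 0 < endow i
  limit_pos : ∀ i, 0 < limit i

variable {Asset I : Type} [Fintype Asset] [Fintype I]

/-- `(p, lam)` is an equilibrium: prices are strictly positive, fill fractions
lie in `[0,1]`, offers strictly in the money fill fully, offers strictly out of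
the money do not fill, and each asset's amount sold equals the amount bought. -/
noncomputable def IsEquilibrium (M : Market Asset I) (p : Asset → ℝ) (lam : I → ℝ) : Prop :=
  (∀ A, 0 < p A) ∧
  (∀ i, lam i ∈ Set.Icc (0:ℝ) 1) ∧
  (∀ i, M.limit i * p (M.buy i) < p (M.sell i) → lam i = 1) ∧
  (∀ i, p (M.sell i) < M.limit i * p (M.buy i) → lam i = 0) ∧
  (∀ A, (∑ i : I, if M.sell i = A then lam i * M.endow i else 0) =
        (∑ i : I, if M.buy i = A then lam i * M.endow i * p (M.sell i) / p (M.buy i) else 0))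

/-- `tradeAmt M lam A B` is the total amount of asset `A` sold in exchange for `B`. -/
noncomputable def tradeAmt (M : Market Asset I) (lam : I → ℝ) (A B : Asset) : ℝ :=
  ∑ i : I, if M.sell i = A ∧ M.buy i = B then lam i * M.endow i else 0

/-- The value traded by an offer with endowment `e` and limit price `α`, at price `x` of the sold
asset and `y` of the bought asset, when the fill fraction is the continuous response
`max 0 (min 1 (n * (1 - α * y / x)))`. -/
noncomputable def smoothFill (e α n x y : ℝ) : ℝ := e * max 0 (min x (n * (x - α * y)))

lemma smoothFill_nonneg {e : ℝ} (he : 0 ≤ e) (α n x y : ℝ) : 0 ≤ smoothFill e α n x y :=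
  mul_nonneg he (le_max_left _ _)

lemma smoothFill_le {e x : ℝ} (he : 0 ≤ e) (hx : 0 ≤ x) (α n y : ℝ) :
    smoothFill e α n x y ≤ e * x :=
  mul_le_mul_of_nonneg_left (max_le hx (min_le_left _ _)) he

lemma smoothFill_eq_zero_of_nonpos {x : ℝ} (hx : x ≤ 0) (e α n y : ℝ) :
    smoothFill e α n x y = 0 := by
  rw [smoothFill, max_eq_left ((min_le_left _ _).trans hx), mul_zero]

lemma smoothFill_eq_zero {α n x y : ℝ} (hn : 0 ≤ n) (hxy : x ≤ α * y) (e : ℝ) :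
    smoothFill e α n x y = 0 := by
  have h : n * (x - α * y) ≤ 0 := mul_nonpos_of_nonneg_of_nonpos hn (by linarith)
  rw [smoothFill, max_eq_left ((min_le_right _ _).trans h), mul_zero]

lemma smoothFill_pos {e α n x y : ℝ} (he : 0 < e) (hn : 0 < n) (hx : 0 < x) (hxy : α * y < x) :
    0 < smoothFill e α n x y :=
  mul_pos he (lt_max_of_lt_right (lt_min hx (mul_pos hn (by linarith))))

lemma smoothFill_sub_left_mem {e α n : ℝ} (he : 0 ≤ e) (hn : 1 ≤ n) {x x' : ℝ} (hx : x ≤ x')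
    (y : ℝ) :
    0 ≤ smoothFill e α n x' y - smoothFill e α n x y ∧
      smoothFill e α n x' y - smoothFill e α n x y ≤ e * n * (x' - x) := by
  have h1 : n * (x - α * y) ≤ n * (x' - α * y) :=
    mul_le_mul_of_nonneg_left (by linarith) (by linarith)
  have h2 : x' - x ≤ n * (x' - x) := le_mul_of_one_le_left (by linarith) hn
  have key : 0 ≤ max 0 (min x' (n * (x' - α * y))) - max 0 (min x (n * (x - α * y))) ∧
      max 0 (min x' (n * (x' - α * y))) - max 0 (min x (n * (x - α * y))) ≤ n * (x' - x) := by
    constructor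
    · exact sub_nonneg.2 (max_le_max le_rfl (min_le_min hx h1))
    · rw [sub_le_iff_le_add]
      refine max_le (by linarith [le_max_left 0 (min x (n * (x - α * y)))]) ?_
      rcases min_cases x (n * (x - α * y)) with ⟨h, _⟩ | ⟨h, _⟩
      · have := le_max_right 0 (min x (n * (x - α * y)))
        have := min_le_left x' (n * (x' - α * y))
        linarith
      · have := le_max_right 0 (min x (n * (x - α * y)))
        have := min_le_right x' (n * (x' - α * y))
        linarith
  unfold smoothFill
  rw [← mul_sub, mul_assoc]
  exact ⟨mul_nonneg he key.1, mul_le_mul_of_nonneg_left key.2 he⟩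

lemma smoothFill_sub_right_mem {e α n : ℝ} (he : 0 ≤ e) (hα : 0 ≤ α) (hn : 0 ≤ n) (x : ℝ)
    {y y' : ℝ} (hy : y ≤ y') :
    0 ≤ smoothFill e α n x y - smoothFill e α n x y' ∧
      smoothFill e α n x y - smoothFill e α n x y' ≤ e * n * α * (y' - y) := by
  have h0 : 0 ≤ n * (α * (y' - y)) := mul_nonneg hn (mul_nonneg hα (by linarith))
  have h1 : n * (x - α * y') ≤ n * (x - α * y) := by linarith
  have key : 0 ≤ max 0 (min x (n * (x - α * y))) - max 0 (min x (n * (x - α * y'))) ∧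
      max 0 (min x (n * (x - α * y))) - max 0 (min x (n * (x - α * y'))) ≤
        n * (α * (y' - y)) := by
    constructor
    · exact sub_nonneg.2 (max_le_max le_rfl (min_le_min le_rfl h1))
    · rw [sub_le_iff_le_add]
      have h3 := le_max_left 0 (min x (n * (x - α * y')))
      have h4 := le_max_right 0 (min x (n * (x - α * y')))
      refine max_le (by linarith) ?_
      rcases min_cases x (n * (x - α * y')) with ⟨h, _⟩ | ⟨h, _⟩
      · have := min_le_left x (n * (x - α * y))
        linarith
      · have := min_le_right x (n * (x - α * y))
        linarith
  unfold smoothFill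
  rw [← mul_sub, mul_assoc, mul_assoc]
  exact ⟨mul_nonneg he key.1, mul_le_mul_of_nonneg_left key.2 he⟩

lemma smoothFill_sub_left_abs {e α n c : ℝ} (he : 0 ≤ e) (hn : 1 ≤ n) (hc : 0 ≤ c)
    (hcn : c * (e * n) ≤ 1) (x x' y : ℝ) :
    |x - x' - c * (smoothFill e α n x y - smoothFill e α n x' y)| +
      |c * (smoothFill e α n x y - smoothFill e α n x' y)| = |x - x'| := by
  rcases le_total x x' with h | h
  · obtain ⟨h1, h2⟩ := smoothFill_sub_left_mem (α := α) he hn h y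
    have h3 := mul_nonneg hc h1
    have h4 := mul_le_mul_of_nonneg_left h2 hc
    have h5 := mul_le_mul_of_nonneg_right hcn (sub_nonneg.2 h)
    rw [abs_of_nonpos (by linarith), abs_of_nonpos (by linarith), abs_of_nonpos (by linarith)]
    ring
  · obtain ⟨h1, h2⟩ := smoothFill_sub_left_mem (α := α) he hn h y
    have h3 := mul_nonneg hc h1
    have h4 := mul_le_mul_of_nonneg_left h2 hc
    have h5 := mul_le_mul_of_nonneg_right hcn (sub_nonneg.2 h)
    rw [abs_of_nonneg (by linarith), abs_of_nonneg (by linarith), abs_of_nonneg (by linarith)]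
    ring

lemma smoothFill_sub_right_abs {e α n c : ℝ} (he : 0 ≤ e) (hα : 0 ≤ α) (hn : 0 ≤ n) (hc : 0 ≤ c)
    (hcn : c * (e * n * α) ≤ 1) (x y y' : ℝ) :
    |y - y' + c * (smoothFill e α n x y - smoothFill e α n x y')| +
      |c * (smoothFill e α n x y - smoothFill e α n x y')| = |y - y'| := by
  rcases le_total y y' with h | h
  · obtain ⟨h1, h2⟩ := smoothFill_sub_right_mem he hα hn x h
    have h3 := mul_nonneg hc h1
    have h4 := mul_le_mul_of_nonneg_left h2 hc
    have h5 := mul_le_mul_of_nonneg_right hcn (sub_nonneg.2 h)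
    rw [abs_of_nonpos (by linarith), abs_of_nonneg (by linarith), abs_of_nonpos (by linarith)]
    ring
  · obtain ⟨h1, h2⟩ := smoothFill_sub_right_mem he hα hn x h
    have h3 := mul_nonneg hc h1
    have h4 := mul_le_mul_of_nonneg_left h2 hc
    have h5 := mul_le_mul_of_nonneg_right hcn (sub_nonneg.2 h)
    rw [abs_of_nonneg (by linarith), abs_of_nonpos (by linarith), abs_of_nonneg (by linarith)]
    ring

/-- Moving the value traded by one offer from its seller to its buyer is `ℓ¹`-nonexpansive. -/
lemma sum_abs_transfer_le {V : Type} [Fintype V] {e α n c : ℝ} (he : 0 ≤ e) (hα : 0 ≤ α)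
    (hn : 1 ≤ n) (hc : 0 ≤ c) (h1 : c * (e * n) ≤ 1) (h2 : c * (e * n * α) ≤ 1)
    (p q : V → ℝ) (S B : V) :
    ∑ a, |p a - q a + c * (smoothFill e α n (p S) (p B) - smoothFill e α n (q S) (q B)) *
        ((if B = a then 1 else 0) - (if S = a then 1 else 0))| ≤ ∑ a, |p a - q a| := by
  by_cases hSB : S = B
  · simp [hSB]
  set D := c * (smoothFill e α n (p S) (p B) - smoothFill e α n (q S) (q B))
  have key : |p S - q S - D| + |p B - q B + D| ≤ |p S - q S| + |p B - q B| := by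
    have hl := smoothFill_sub_left_abs (α := α) he hn hc h1 (p S) (q S) (p B)
    have hr := smoothFill_sub_right_abs he hα (by linarith) hc h2 (q S) (p B) (q B)
    set D₁ := c * (smoothFill e α n (p S) (p B) - smoothFill e α n (q S) (p B))
    set D₂ := c * (smoothFill e α n (q S) (p B) - smoothFill e α n (q S) (q B))
    have hsum : D = D₁ + D₂ := by simp only [D, D₁, D₂]; ring
    have t1 : |p S - q S - D| ≤ |p S - q S - D₁| + |D₂| := by
      rw [hsum, ← sub_sub]; exact abs_sub _ _
    have t2 : |p B - q B + D| ≤ |p B - q B + D₂| + |D₁| := by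
      rw [hsum, add_comm D₁, ← add_assoc]; exact abs_add_le _ _
    linarith
  have hpt : ∀ a, |p a - q a + D * ((if B = a then 1 else 0) - (if S = a then 1 else 0))| =
      |p a - q a| + ((if S = a then |p S - q S - D| - |p S - q S| else 0) +
        (if B = a then |p B - q B + D| - |p B - q B| else 0)) := by
    intro a
    by_cases hS : S = a
    · subst hS
      simp [Ne.symm hSB, sub_eq_add_neg]
    · by_cases hB : B = a
      · subst hB
        simp [hS]
      · simp [hS, hB]
  simp only [hpt, Finset.sum_add_distrib, Finset.sum_ite_eq, Finset.mem_univ, if_true]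
  linarith

/-- Prices at which the smoothed market clears up to the perturbation `s * (1 - p a)`. -/
lemma exists_smoothed_clearing {V J : Type} [Fintype V] [Fintype J] [Nonempty J]
    (S B : J → V) (e α : J → ℝ) (he : ∀ j, 0 ≤ e j) (hα : ∀ j, 0 ≤ α j) {n s : ℝ} (hn : 1 ≤ n)
    (hs : 0 < s) :
    ∃ p : V → ℝ, ∀ a, ∑ j, smoothFill (e j) (α j) n (p (S j)) (p (B j)) *
      ((if S j = a then 1 else 0) - (if B j = a then 1 else 0)) = s * (1 - p a) := by
  obtain ⟨c, hc, h1, h2⟩ : ∃ c : ℝ, 0 < c ∧ (∀ j, c * (e j * n) ≤ 1) ∧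
      ∀ j, c * (e j * n * α j) ≤ 1 := by
    have hnn : ∀ j, 0 ≤ e j * n * (1 + α j) := fun j =>
      mul_nonneg (mul_nonneg (he j) (by linarith)) (by linarith [hα j])
    have hC : 0 < 1 + ∑ j, e j * n * (1 + α j) := by
      have := Finset.sum_nonneg fun j (_ : j ∈ Finset.univ) => hnn j
      linarith
    have hle : ∀ j, e j * n * (1 + α j) ≤ 1 + ∑ j, e j * n * (1 + α j) := fun j => by
      have := Finset.single_le_sum (fun j _ => hnn j) (Finset.mem_univ j)
      linarith
    refine ⟨(1 + ∑ j, e j * n * (1 + α j))⁻¹, inv_pos.2 hC, fun j => ?_, fun j => ?_⟩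
    all_goals
      rw [inv_mul_le_one₀ hC]
      have h3 : 0 ≤ e j * n := mul_nonneg (he j) (by linarith)
      have h4 := mul_nonneg h3 (hα j)
      linarith [hle j]
  set N : ℝ := (Fintype.card J : ℝ) with hN
  have hNpos : 0 < N := by
    rw [hN]; exact_mod_cast Fintype.card_pos
  set φ : (V → ℝ) → J → ℝ := fun p j => smoothFill (e j) (α j) n (p (S j)) (p (B j)) with hφ
  set G : (V → ℝ) → V → ℝ := fun p a => p a + (c / N) * ∑ j, φ p j *
      ((if B j = a then 1 else 0) - (if S j = a then 1 else 0)) with hG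
  have hG1 : ∀ p q, ∑ a, |G p a - G q a| ≤ ∑ a, |p a - q a| := by
    intro p q
    have hrew : ∀ a, G p a - G q a = N⁻¹ * ∑ j, (p a - q a + c * (φ p j - φ q j) *
        ((if B j = a then 1 else 0) - (if S j = a then 1 else 0))) := by
      intro a
      have hE : ∑ j : J, (p a - q a) = N * (p a - q a) := by
        rw [Finset.sum_const, Finset.card_univ, nsmul_eq_mul]
      rw [Finset.sum_add_distrib, hE, mul_add, inv_mul_cancel_left₀ hNpos.ne']
      simp only [hG, mul_sub c, sub_mul, Finset.sum_sub_distrib, mul_assoc c, ← Finset.mul_sum]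
      field_simp
      ring
    calc ∑ a, |G p a - G q a|
        ≤ ∑ a, N⁻¹ * ∑ j, |p a - q a + c * (φ p j - φ q j) *
            ((if B j = a then 1 else 0) - (if S j = a then 1 else 0))| := by
          refine Finset.sum_le_sum fun a _ => ?_
          rw [hrew, abs_mul, abs_of_pos (inv_pos.2 hNpos)]
          exact mul_le_mul_of_nonneg_left (Finset.abs_sum_le_sum_abs _ _) (inv_pos.2 hNpos).le
      _ = N⁻¹ * ∑ j, ∑ a, |p a - q a + c * (φ p j - φ q j) *
            ((if B j = a then 1 else 0) - (if S j = a then 1 else 0))| := by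
          rw [← Finset.mul_sum, Finset.sum_comm]
      _ ≤ N⁻¹ * ∑ _j : J, ∑ a, |p a - q a| := by
          refine mul_le_mul_of_nonneg_left (Finset.sum_le_sum fun j _ => ?_) (inv_pos.2 hNpos).le
          exact sum_abs_transfer_le (he j) (hα j) hn hc.le (h1 j) (h2 j) p q (S j) (B j)
      _ = ∑ a, |p a - q a| := by
          rw [Finset.sum_const, Finset.card_univ, nsmul_eq_mul, inv_mul_cancel_left₀ hNpos.ne']
  set τ : ℝ := s * (c / N) with hτ
  have hτpos : 0 < τ := by positivity
  let F : PiLp 1 (fun _ : V => ℝ) → PiLp 1 (fun _ : V => ℝ) :=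
    fun p => WithLp.toLp 1 fun a => (1 + τ)⁻¹ * (G (fun b => p b) a + τ)
  have hF : ContractingWith (Real.toNNReal (1 + τ)⁻¹) F := by
    refine ⟨?_, LipschitzWith.of_dist_le_mul fun p q => ?_⟩
    · rw [Real.toNNReal_lt_one]
      exact inv_lt_one_of_one_lt₀ (by linarith)
    · rw [Real.coe_toNNReal _ (by positivity), PiLp.dist_eq_of_L1, PiLp.dist_eq_of_L1]
      simp only [Real.dist_eq, F]
      calc _ = (1 + τ)⁻¹ * ∑ a, |G (fun b => p b) a - G (fun b => q b) a| := by
            rw [Finset.mul_sum]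
            refine Finset.sum_congr rfl fun a _ => ?_
            rw [← mul_sub, abs_mul, abs_of_pos (by positivity : 0 < (1 + τ)⁻¹)]
            congr 2
            ring
        _ ≤ _ := mul_le_mul_of_nonneg_left (hG1 _ _) (by positivity)
  obtain ⟨p, hp⟩ : ∃ p, F p = p := ⟨_, hF.fixedPoint_isFixedPt⟩
  refine ⟨fun a => p a, fun a => ?_⟩
  have ha : (1 + τ)⁻¹ * (G (fun b => p b) a + τ) = p a := congrArg (fun q => q a) hp
  rw [inv_mul_eq_iff_eq_mul₀ (by positivity)] at ha
  have hneg : ∑ j, φ (fun b => p b) j * ((if B j = a then 1 else 0) - (if S j = a then 1 else 0)) =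
      -∑ j, φ (fun b => p b) j * ((if S j = a then 1 else 0) - (if B j = a then 1 else 0)) := by
    rw [← Finset.sum_neg_distrib]
    exact Finset.sum_congr rfl fun j _ => by ring
  simp only [hG] at ha
  rw [hneg, hτ] at ha
  have hcN : 0 < c / N := by positivity
  apply mul_left_cancel₀ hcN.ne'
  linarith

/-- If some price exceeds another by a factor `K ^ card V`, then the prices split into a high and
a low group separated by a factor `K`. -/
lemma exists_price_gap {V : Type} [Fintype V] {p : V → ℝ} (hp : ∀ a, 0 < p a) {K : ℝ}
    (hK : 1 ≤ K) {a b : V} (hab : K ^ Fintype.card V * p b < p a) :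
    ∃ H : Finset V, a ∈ H ∧ b ∉ H ∧ ∀ h ∈ H, ∀ l ∉ H, K * p l < p h := by
  let H : ℕ → Finset V := fun k => Finset.univ.filter fun c => K ^ k * p b < p c
  have hmem : ∀ k c, c ∈ H k ↔ K ^ k * p b < p c := fun k c => by simp [H]
  have hanti : ∀ {k l : ℕ}, k ≤ l → H l ⊆ H k := fun {k l} hkl c hc => by
    rw [hmem] at hc ⊢
    exact (mul_le_mul_of_nonneg_right (pow_le_pow_right₀ hK hkl) (hp b).le).trans_lt hc
  obtain ⟨k, hk, hkeq⟩ : ∃ k < Fintype.card V, H (k + 1) = H k := by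
    by_contra! hne
    have hcard : ∀ k ≤ Fintype.card V, (H k).card + k ≤ (H 0).card := by
      intro k
      induction k with
      | zero => simp
      | succ k ih =>
        intro hk
        have hlt := Finset.card_lt_card
          ((hanti (Nat.le_succ k)).ssubset_of_ne (hne k (by omega)))
        have := ih (by omega)
        simp only [Nat.succ_eq_add_one] at hlt
        omega
    have h1 := hcard _ le_rfl
    have h2 : (H 0).card < Fintype.card V := by
      rw [← Finset.card_univ]
      refine Finset.card_lt_card (Finset.ssubset_univ_iff.2 fun h => ?_)
      have : b ∈ H 0 := h ▸ Finset.mem_univ b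
      rw [hmem] at this
      simp at this
    omega
  refine ⟨H k, ?_, ?_, fun h hh l hl => ?_⟩
  · exact hanti hk.le ((hmem _ _).2 hab)
  · rw [hmem, not_lt]
    exact le_mul_of_one_le_left (hp b).le (one_le_pow₀ hK)
  · rw [← hkeq, hmem] at hh
    rw [hmem, not_lt] at hl
    calc K * p l ≤ K * (K ^ k * p b) := mul_le_mul_of_nonneg_left hl (by linarith)
      _ = K ^ (k + 1) * p b := by ring
      _ < p h := hh

/-- Smoothed clearing prices with pairwise ratios bounded independently of the smoothing. -/
lemma exists_bounded_smoothed_clearing {V J : Type} [Fintype V] [Nonempty V] [Fintype J]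
    (S B : J → V) (e α : J → ℝ) (he : ∀ j, 0 ≤ e j) (hα : ∀ j, 0 < α j) :
    ∃ M : ℝ, 0 < M ∧ ∀ n s : ℝ, 1 ≤ n → 0 < s → ∃ p : V → ℝ, (∀ a, 0 < p a) ∧
      ∑ a, p a = Fintype.card V ∧ (∀ a b, p a ≤ M * p b) ∧
      ∀ a, ∑ j, smoothFill (e j) (α j) n (p (S j)) (p (B j)) *
        ((if S j = a then 1 else 0) - (if B j = a then 1 else 0)) = s * (1 - p a) := by
  set K : ℝ := 1 + ∑ j, (α j)⁻¹ with hKdef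
  have hK : 1 ≤ K := by
    have := Finset.sum_nonneg fun j (_ : j ∈ Finset.univ) => (inv_pos.2 (hα j)).le
    linarith
  have hKα : ∀ j, 1 ≤ α j * K := fun j => by
    have := Finset.single_le_sum (fun j _ => (inv_pos.2 (hα j)).le) (Finset.mem_univ j)
    rw [← mul_inv_cancel₀ (hα j).ne']
    exact mul_le_mul_of_nonneg_left (by linarith) (hα j).le
  set M : ℝ := K ^ Fintype.card V
  have hM : 1 ≤ M := one_le_pow₀ hK
  refine ⟨M, by linarith, fun n s hn hs => ?_⟩
  let S' : J ⊕ V × V → V := Sum.elim S Prod.fst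
  let B' : J ⊕ V × V → V := Sum.elim B Prod.snd
  let e' : J ⊕ V × V → ℝ := Sum.elim e fun _ => 1
  let α' : J ⊕ V × V → ℝ := Sum.elim α fun _ => M
  have he' : ∀ j, 0 ≤ e' j := by rintro (j | j) <;> simp [e', he]
  have hα' : ∀ j, 0 < α' j := by
    rintro (j | j)
    · exact hα j
    · exact zero_lt_one.trans_le hM
  have hKα' : ∀ j, 1 ≤ α' j * K := by
    rintro (j | j)
    · exact hKα j
    · exact one_le_mul_of_one_le_of_one_le hM hK
  obtain ⟨p, hp⟩ := exists_smoothed_clearing S' B' e' α' he' (fun j => (hα' j).le) hn hs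
  set φ : J ⊕ V × V → ℝ := fun j => smoothFill (e' j) (α' j) n (p (S' j)) (p (B' j)) with hφ
  have hφ0 : ∀ j, 0 ≤ φ j := fun j => smoothFill_nonneg (he' j) _ _ _ _
  have hpos : ∀ a, 0 < p a := by
    intro a
    by_contra! hle
    have hneg : ∑ j, φ j * ((if S' j = a then 1 else 0) - (if B' j = a then 1 else 0)) ≤ 0 := by
      refine Finset.sum_nonpos fun j _ => ?_
      by_cases hS : S' j = a
      · have : φ j = 0 := smoothFill_eq_zero_of_nonpos (hS ▸ hle) _ _ _ _
        simp [this]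
      · rw [if_neg hS]
        refine mul_nonpos_of_nonneg_of_nonpos (hφ0 j) ?_
        split_ifs <;> norm_num
    have h1 := hp a
    have h2 : 0 < s * (1 - p a) := mul_pos hs (by linarith)
    linarith
  have hsum0 : ∑ a, (1 - p a) = 0 := by
    have h1 : s * ∑ a, (1 - p a) = 0 := by
      rw [Finset.mul_sum, ← Finset.sum_congr rfl fun a _ => hp a, Finset.sum_comm]
      refine Finset.sum_eq_zero fun j _ => ?_
      rw [← Finset.mul_sum, Finset.sum_sub_distrib]
      simp
    exact (mul_eq_zero.1 h1).resolve_left hs.ne'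
  have hbound : ∀ a b, p a ≤ M * p b := by
    intro a b
    by_contra! hab
    obtain ⟨H, haH, hbH, hH⟩ := exists_price_gap hpos hK hab
    have hHle : ∑ c ∈ H, (1 - p c) ≤ 0 := by
      by_contra! hgt
      obtain ⟨h, hh, hlt⟩ := Finset.exists_lt_of_sum_lt
        (show ∑ c ∈ H, (0 : ℝ) < ∑ c ∈ H, (1 - p c) by simpa using hgt)
      have hcompl : 0 ≤ ∑ c ∈ Hᶜ, (1 - p c) := Finset.sum_nonneg fun l hl => by
        have h1 := hH h hh l (by simpa using hl)
        have h2 := le_mul_of_one_le_left (hpos l).le hK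
        linarith
      have := Finset.sum_add_sum_compl H fun c => 1 - p c
      linarith
    have hflow : ∑ j, φ j * ((if S' j ∈ H then 1 else 0) - (if B' j ∈ H then 1 else 0)) =
        s * ∑ c ∈ H, (1 - p c) := by
      rw [Finset.mul_sum, ← Finset.sum_congr rfl fun a _ => hp a, Finset.sum_comm]
      refine Finset.sum_congr rfl fun j _ => ?_
      rw [← Finset.mul_sum, Finset.sum_sub_distrib]
      simp [hφ]
    have hterm : ∀ j, 0 ≤ φ j * ((if S' j ∈ H then 1 else 0) - (if B' j ∈ H then 1 else 0)) := by
      intro j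
      by_cases hS : S' j ∈ H
      · rw [if_pos hS]
        refine mul_nonneg (hφ0 j) ?_
        split_ifs <;> norm_num
      · by_cases hB : B' j ∈ H
        · have h1 := hH _ hB _ hS
          have h2 : p (S' j) ≤ α' j * p (B' j) := by
            calc p (S' j) ≤ α' j * K * p (S' j) :=
                  le_mul_of_one_le_left (hpos _).le (hKα' j)
              _ = α' j * (K * p (S' j)) := mul_assoc _ _ _
              _ ≤ α' j * p (B' j) := mul_le_mul_of_nonneg_left h1.le (hα' j).le
          have : φ j = 0 := smoothFill_eq_zero (by linarith) h2 _
          simp [this]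
        · simp [hS, hB]
    have hstrict : 0 < φ (Sum.inr (a, b)) *
        ((if S' (Sum.inr (a, b)) ∈ H then 1 else 0) -
          (if B' (Sum.inr (a, b)) ∈ H then 1 else 0)) := by
      have h1 : 0 < φ (Sum.inr (a, b)) :=
        smoothFill_pos one_pos (by linarith) (hpos a) hab
      simpa [S', B', haH, hbH] using h1
    have := Finset.single_le_sum (fun j _ => hterm j) (Finset.mem_univ (Sum.inr (a, b)))
    have := mul_nonpos_of_nonneg_of_nonpos hs.le hHle
    linarith
  refine ⟨p, hpos, ?_, hbound, fun a => ?_⟩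
  · rw [Finset.sum_sub_distrib] at hsum0
    simp at hsum0
    linarith
  · rw [← hp a, Fintype.sum_sum_type]
    have : ∀ x : V × V, smoothFill 1 M n (p x.1) (p x.2) = 0 := fun x =>
      smoothFill_eq_zero (by linarith) (hbound x.1 x.2) _
    simp only [S', B', e', α', Sum.elim_inl, Sum.elim_inr, this, zero_mul, Finset.sum_const_zero,
      add_zero]
    rfl

/-- Positive prices together with traded values `y` forming a circulation that respects the limit
prices: the value form of an equilibrium. -/
lemma exists_value_equilibrium {V J : Type} [Fintype V] [Nonempty V] [Fintype J]
    (S B : J → V) (e α : J → ℝ) (he : ∀ j, 0 ≤ e j) (hα : ∀ j, 0 < α j) :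
    ∃ (p : V → ℝ) (y : J → ℝ), (∀ a, 0 < p a) ∧
      (∀ j, 0 ≤ y j ∧ y j ≤ e j * p (S j)) ∧
      (∀ j, (e j * p (S j) - y j) * (p (S j) - α j * p (B j)) ≤ 0) ∧
      (∀ j, y j * (α j * p (B j) - p (S j)) ≤ 0) ∧
      ∀ a, ∑ j, y j * ((if S j = a then 1 else 0) - (if B j = a then 1 else 0)) = 0 := by
  obtain ⟨M, hM, hex⟩ := exists_bounded_smoothed_clearing S B e α he hα
  set C : ℝ := (Fintype.card V : ℝ) with hC
  have hCpos : 0 < C := by rw [hC]; exact_mod_cast Fintype.card_pos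
  have hapx : ∀ k : ℕ, ∃ x : (V → ℝ) × (J → ℝ), x ∈ Set.Icc 0 (fun _ => C, fun j => e j * C) ∧
      ∑ a, x.1 a = C ∧ (∀ a b, x.1 a ≤ M * x.1 b) ∧
      (∀ j, x.2 j ≤ e j * x.1 (S j)) ∧
      (∀ j, (e j * x.1 (S j) - x.2 j) * (x.1 (S j) - α j * x.1 (B j)) ≤
        e j * C * C * (1 / ((k : ℝ) + 1))) ∧
      (∀ j, x.2 j * (α j * x.1 (B j) - x.1 (S j)) ≤ 0) ∧
      ∀ a, ∑ j, x.2 j * ((if S j = a then 1 else 0) - (if B j = a then 1 else 0)) =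
        (1 / ((k : ℝ) + 1)) * (1 - x.1 a) := by
    intro k
    have hk : (1 : ℝ) ≤ (k : ℝ) + 1 := by simp
    have hk0 : (0 : ℝ) < (k : ℝ) + 1 := by linarith
    obtain ⟨p, hpos, hsum, hb, hz⟩ := hex (k + 1) (1 / ((k : ℝ) + 1)) hk (by positivity)
    have hpC : ∀ a, p a ≤ C := fun a => by
      rw [← hsum]
      exact Finset.single_le_sum (fun b _ => (hpos b).le) (Finset.mem_univ a)
    refine ⟨(p, fun j => smoothFill (e j) (α j) (k + 1) (p (S j)) (p (B j))),
      ⟨⟨fun a => (hpos a).le, fun j => smoothFill_nonneg (he j) _ _ _ _⟩,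
        ⟨hpC, fun j => (smoothFill_le (he j) (hpos _).le _ _ _).trans
          (mul_le_mul_of_nonneg_left (hpC _) (he j))⟩⟩, hsum, hb,
      fun j => smoothFill_le (he j) (hpos _).le _ _ _, fun j => ?_, fun j => ?_, hz⟩
    · dsimp only
      have hrhs : 0 ≤ e j * C * C * (1 / ((k : ℝ) + 1)) := by
        have := he j
        positivity
      have hgap : 0 ≤ e j * p (S j) - smoothFill (e j) (α j) (k + 1) (p (S j)) (p (B j)) :=
        sub_nonneg.2 (smoothFill_le (he j) (hpos _).le _ _ _)
      rcases le_total (p (S j)) (((k : ℝ) + 1) * (p (S j) - α j * p (B j))) with h | h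
      · rw [smoothFill, min_eq_left h, max_eq_right (hpos _).le, sub_self, zero_mul]
        exact hrhs
      · rcases le_total (p (S j) - α j * p (B j)) 0 with h' | h'
        · exact (mul_nonpos_of_nonneg_of_nonpos hgap h').trans hrhs
        · have h1 : p (S j) - α j * p (B j) ≤ C * (1 / ((k : ℝ) + 1)) := by
            rw [mul_one_div, le_div_iff₀ hk0, mul_comm]
            exact h.trans (hpC _)
          have h2 : e j * p (S j) - smoothFill (e j) (α j) (k + 1) (p (S j)) (p (B j)) ≤
              e j * C := by
            have := smoothFill_nonneg (he j) (α j) (k + 1) (p (S j)) (p (B j))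
            have := mul_le_mul_of_nonneg_left (hpC (S j)) (he j)
            linarith
          calc _ ≤ (e j * C) * (C * (1 / ((k : ℝ) + 1))) :=
                mul_le_mul h2 h1 h' (mul_nonneg (he j) hCpos.le)
            _ = _ := by ring
    · dsimp only
      rcases le_total (p (S j)) (α j * p (B j)) with h | h
      · rw [smoothFill_eq_zero hk0.le h, zero_mul]
      · exact mul_nonpos_of_nonneg_of_nonpos (smoothFill_nonneg (he j) _ _ _ _) (by linarith)
  choose x hxI hxsum hxb hxle hxfull hxzero hxz using hapx
  have hcompact : IsCompact
      (Set.Icc (0 : (V → ℝ) × (J → ℝ)) (fun _ => C, fun j => e j * C)) := by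
    rw [← Prod.mk_zero_zero, ← Set.Icc_prod_Icc]
    exact isCompact_Icc.prod isCompact_Icc
  obtain ⟨z, hzI, σ, hσ, hlim⟩ := hcompact.tendsto_subseq hxI
  have hp : ∀ a, Filter.Tendsto (fun k => (x (σ k)).1 a) Filter.atTop (nhds (z.1 a)) := fun a =>
    (((continuous_apply a).comp continuous_fst).tendsto z).comp hlim
  have hy : ∀ j, Filter.Tendsto (fun k => (x (σ k)).2 j) Filter.atTop (nhds (z.2 j)) := fun j =>
    (((continuous_apply j).comp continuous_snd).tendsto z).comp hlim
  have hε : Filter.Tendsto (fun k => 1 / ((σ k : ℝ) + 1)) Filter.atTop (nhds 0) :=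
    tendsto_one_div_add_atTop_nhds_zero_nat.comp hσ.tendsto_atTop
  have hsum : ∑ a, z.1 a = C :=
    tendsto_nhds_unique (tendsto_finsetSum _ fun a _ => hp a)
      (by simp only [hxsum]; exact tendsto_const_nhds)
  have hb : ∀ a b, z.1 a ≤ M * z.1 b := fun a b =>
    le_of_tendsto_of_tendsto' (hp a) ((hp b).const_mul M) fun k => hxb _ a b
  have hpos : ∀ a, 0 < z.1 a := by
    intro a
    obtain ⟨b, -, hb'⟩ := Finset.exists_lt_of_sum_lt
      (show ∑ c : V, (0 : ℝ) < ∑ c, z.1 c by rw [hsum]; simpa using hCpos)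
    exact pos_of_mul_pos_right (hb'.trans_le (hb b a)) hM.le
  refine ⟨z.1, z.2, hpos, fun j => ⟨hzI.1.2 j, ?_⟩, fun j => ?_, fun j => ?_, fun a => ?_⟩
  · exact le_of_tendsto_of_tendsto' (hy j) ((hp _).const_mul _) fun k => hxle _ j
  · have hr := hε.const_mul (e j * C * C)
    rw [mul_zero] at hr
    exact le_of_tendsto_of_tendsto' ((((hp (S j)).const_mul (e j)).sub (hy j)).mul
      ((hp (S j)).sub ((hp (B j)).const_mul (α j)))) hr fun k => hxfull _ j
  · exact le_of_tendsto' ((hy j).mul (((hp (B j)).const_mul (α j)).sub (hp (S j))))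
      fun k => hxzero _ j
  · have hr := hε.mul ((hp a).const_sub 1)
    rw [zero_mul] at hr
    refine tendsto_nhds_unique (tendsto_finsetSum _ fun j _ => (hy j).mul_const _) (hr.congr ?_)
    exact fun k => (hxz (σ k) a).symm

/-- every linear exchange market with limit sell offers admits an
equilibrium. -/
theorem market_equilibrium_exists {Asset I : Type} [Fintype Asset] [Nonempty Asset]
    [Fintype I] (M : Market Asset I) :
    ∃ (p : Asset → ℝ) (lam : I → ℝ), IsEquilibrium M p lam := by
  obtain ⟨p, y, hpos, hy, hfull, hzero, hz⟩ := exists_value_equilibrium M.sell M.buy M.endow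
    M.limit (fun i => (M.endow_pos i).le) M.limit_pos
  have hep : ∀ i, 0 < M.endow i * p (M.sell i) := fun i => mul_pos (M.endow_pos i) (hpos _)
  have hlam : ∀ i, y i / (M.endow i * p (M.sell i)) * M.endow i = y i / p (M.sell i) := fun i => by
    have := (M.endow_pos i).ne'
    have := (hpos (M.sell i)).ne'
    field_simp
  refine ⟨p, fun i => y i / (M.endow i * p (M.sell i)), hpos, fun i => ⟨?_, ?_⟩, fun i hi => ?_,
    fun i hi => ?_, fun A => ?_⟩
  · exact div_nonneg (hy i).1 (hep i).le
  · exact div_le_one_of_le₀ (hy i).2 (hep i).le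
  · rw [div_eq_one_iff_eq (hep i).ne']
    have := nonpos_of_mul_nonpos_left (hfull i) (sub_pos.2 hi)
    linarith [(hy i).2]
  · have := nonpos_of_mul_nonpos_left (hzero i) (sub_pos.2 hi)
    simp only [le_antisymm this (hy i).1, zero_div]
  · have hS : ∀ i, (if M.sell i = A then y i / (M.endow i * p (M.sell i)) * M.endow i else 0) =
        (y i * if M.sell i = A then 1 else 0) / p A := fun i => by
      rw [hlam]
      split_ifs with h
      · rw [h, mul_one]
      · simp
    have hB : ∀ i, (if M.buy i = A then
        y i / (M.endow i * p (M.sell i)) * M.endow i * p (M.sell i) / p (M.buy i) else 0) =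
        (y i * if M.buy i = A then 1 else 0) / p A := fun i => by
      rw [hlam, div_mul_cancel₀ _ (hpos _).ne']
      split_ifs with h
      · rw [h, mul_one]
      · simp
    have h0 := hz A
    simp only [mul_sub, Finset.sum_sub_distrib] at h0
    simp only [hS, hB, ← Finset.sum_div]
    rw [sub_eq_zero.1 h0]
end

section
/- Suppose (p, λ) and (p', λ') are two equilibria of the same linear exchange market with limit sell offers, and there exist assets A and B with p_A / p_B ≠ p'_A / p'_B. Then there exists a partition of the asset set into two sets 𝒜 and ℬ with A ∈ 𝒜 and B ∈ ℬ such that neither equilibrium has any trading activity across the partition: for every pair of assets C ∈ 𝒜 and D ∈ ℬ, x_{CD} = x_{DC} = 0 and x'_{CD} = x'_{DC} = 0. -/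
attribute [local instance] Classical.propDecidable

variable {Asset I : Type} [Fintype Asset] [Fintype I]

/-- At an equilibrium, the value sold out of a set of assets equals the value sold into it. -/
theorem IsEquilibrium.cut_balance {M : Market Asset I} {p : Asset → ℝ} {lam : I → ℝ}
    (h : IsEquilibrium M p lam) (S : Set Asset) :
    (∑ i : I, if M.sell i ∈ S ∧ M.buy i ∉ S then lam i * M.endow i * p (M.sell i) else 0) =
      ∑ i : I, if M.sell i ∉ S ∧ M.buy i ∈ S then lam i * M.endow i * p (M.sell i) else 0 := by
  obtain ⟨hp, -, -, -, hclear⟩ := h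
  have hsell : (∑ A : Asset, if A ∈ S then
        p A * (∑ i : I, if M.sell i = A then lam i * M.endow i else 0) else 0) =
      ∑ i : I, if M.sell i ∈ S then lam i * M.endow i * p (M.sell i) else 0 := by
    simp only [Finset.mul_sum]
    have : ∀ A, (if A ∈ S then ∑ i : I, p A * (if M.sell i = A then lam i * M.endow i else 0)
        else 0) = ∑ i : I, if M.sell i = A then
          (if M.sell i ∈ S then lam i * M.endow i * p (M.sell i) else 0) else 0 := by
      intro A
      split_ifs with hA
      · refine Finset.sum_congr rfl fun i _ => ?_
        split_ifs <;> grind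
      · refine (Finset.sum_eq_zero fun i _ => ?_).symm
        split_ifs <;> grind
    simp only [this]
    rw [Finset.sum_comm]
    simp
  have hbuy : (∑ A : Asset, if A ∈ S then
        p A * (∑ i : I, if M.buy i = A then
          lam i * M.endow i * p (M.sell i) / p (M.buy i) else 0) else 0) =
      ∑ i : I, if M.buy i ∈ S then lam i * M.endow i * p (M.sell i) else 0 := by
    have : ∀ A, (if A ∈ S then p A * (∑ i : I, if M.buy i = A then
          lam i * M.endow i * p (M.sell i) / p (M.buy i) else 0) else 0) =
        ∑ i : I, if M.buy i = A then
          (if M.buy i ∈ S then lam i * M.endow i * p (M.sell i) else 0) else 0 := by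
      intro A
      rw [Finset.mul_sum]
      split_ifs with hA
      · refine Finset.sum_congr rfl fun i _ => ?_
        by_cases hi : M.buy i = A
        · subst hi
          have := (hp (M.buy i)).ne'
          simp only [if_true, hA]
          field_simp
        · simp [hi]
      · refine (Finset.sum_eq_zero fun i _ => ?_).symm
        split_ifs <;> grind
    simp only [this]
    rw [Finset.sum_comm]
    simp
  simp only [hclear] at hsell
  have key := hsell.symm.trans hbuy
  rw [← sub_eq_zero, ← Finset.sum_sub_distrib] at key ⊢
  refine Eq.trans (Finset.sum_congr rfl fun i _ => ?_) key
  by_cases hs : M.sell i ∈ S <;> by_cases hb : M.buy i ∈ S <;> simp [hs, hb]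

/-- If the price of the asset sold rises relative to that of the asset bought, an offer fills at
least as much. -/
theorem IsEquilibrium.fill_le_fill {M : Market Asset I} {p p' : Asset → ℝ} {lam lam' : I → ℝ}
    (h : IsEquilibrium M p lam) (h' : IsEquilibrium M p' lam') {t : ℝ} (ht : 0 < t) {i : I}
    (hlt : t * p (M.sell i) * p' (M.buy i) < p' (M.sell i) * (t * p (M.buy i))) :
    lam i ≤ lam' i := by
  obtain ⟨hp, hl, -, hzero, -⟩ := h
  obtain ⟨hp', hl', hone', -, -⟩ := h'
  rcases lt_or_ge (p (M.sell i)) (M.limit i * p (M.buy i)) with hc | hc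
  · rw [hzero i hc]
    exact (hl' i).1
  · rw [hone' i]
    · exact (hl i).2
    · have h1 : t * (M.limit i * p (M.buy i) * p' (M.buy i)) ≤
          t * (p (M.sell i) * p' (M.buy i)) := by
        have := (hp' (M.buy i)).le
        gcongr
      have h2 : 0 < t * p (M.buy i) := mul_pos ht (hp _)
      refine lt_of_mul_lt_mul_right ?_ h2.le
      linarith

/-- If every price in `S` rises by a factor more than `t` and no price outside `S` does, then no
offer trades across `S` in either equilibrium. -/
theorem IsEquilibrium.fill_eq_zero_of_cut {M : Market Asset I} {p p' : Asset → ℝ}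
    {lam lam' : I → ℝ} (h : IsEquilibrium M p lam) (h' : IsEquilibrium M p' lam')
    {t : ℝ} (ht : 0 < t) {S : Set Asset} (hS : ∀ C ∈ S, t * p C < p' C)
    (hSc : ∀ D ∉ S, p' D ≤ t * p D) {i : I}
    (hi : M.sell i ∈ S ∧ M.buy i ∉ S ∨ M.sell i ∉ S ∧ M.buy i ∈ S) :
    lam i = 0 ∧ lam' i = 0 := by
  have hp := h.1
  have hp' := h'.1
  have hl : ∀ j, 0 ≤ lam j := fun j => (h.2.1 j).1
  have hl' : ∀ j, 0 ≤ lam' j := fun j => (h'.2.1 j).1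
  have hout : ∀ j, M.sell j ∈ S ∧ M.buy j ∉ S → lam j ≤ lam' j := fun j hj =>
    h.fill_le_fill h' ht
      (mul_lt_mul (hS _ hj.1) (hSc _ hj.2) (hp' _) (hp' _).le)
  have hin : ∀ j, M.sell j ∉ S ∧ M.buy j ∈ S → lam' j ≤ lam j := fun j hj => by
    refine h'.fill_le_fill h one_pos ?_
    have := mul_lt_mul' (hSc _ hj.1) (hS _ hj.2) (mul_pos ht (hp _)).le (mul_pos ht (hp _))
    refine lt_of_mul_lt_mul_left ?_ ht.le
    linarith
  have hle_out : ∀ j ∈ Finset.univ,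
      t * (if M.sell j ∈ S ∧ M.buy j ∉ S then lam j * M.endow j * p (M.sell j) else 0) ≤
        if M.sell j ∈ S ∧ M.buy j ∉ S then lam' j * M.endow j * p' (M.sell j) else 0 := by
    intro j _
    split_ifs with hj
    · calc t * (lam j * M.endow j * p (M.sell j)) = lam j * M.endow j * (t * p (M.sell j)) := by
            ring
        _ ≤ lam' j * M.endow j * p' (M.sell j) :=
            mul_le_mul (mul_le_mul_of_nonneg_right (hout j hj) (M.endow_pos j).le) (hS _ hj.1).le
              (mul_pos ht (hp _)).le (mul_nonneg (hl' j) (M.endow_pos j).le)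
    · simp
  have hle_in : ∀ j ∈ Finset.univ,
      (if M.sell j ∉ S ∧ M.buy j ∈ S then lam' j * M.endow j * p' (M.sell j) else 0) ≤
        t * (if M.sell j ∉ S ∧ M.buy j ∈ S then lam j * M.endow j * p (M.sell j) else 0) := by
    intro j _
    split_ifs with hj
    · calc lam' j * M.endow j * p' (M.sell j) ≤ lam j * M.endow j * (t * p (M.sell j)) :=
            mul_le_mul (mul_le_mul_of_nonneg_right (hin j hj) (M.endow_pos j).le) (hSc _ hj.1)
              (hp' _).le (mul_nonneg (hl j) (M.endow_pos j).le)
        _ = t * (lam j * M.endow j * p (M.sell j)) := by ring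
    · simp
  have hbal := h.cut_balance S
  have hsum := Finset.sum_le_sum hle_in
  rw [← h'.cut_balance S, ← Finset.mul_sum, ← hbal, Finset.mul_sum] at hsum
  have heq := (Finset.sum_eq_sum_iff_of_le hle_out).1 ((Finset.sum_le_sum hle_out).antisymm hsum)
  have hout_zero : ∀ j, M.sell j ∈ S ∧ M.buy j ∉ S → lam j = 0 ∧ lam' j = 0 := by
    intro j hj
    have hz' : lam' j = 0 := by
      by_contra hne
      have hpos : 0 < lam' j := lt_of_le_of_ne (hl' j) (Ne.symm hne)
      have e := heq j (Finset.mem_univ j)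
      rw [if_pos hj, if_pos hj] at e
      have h1 : lam' j * M.endow j * (t * p (M.sell j)) < lam' j * M.endow j * p' (M.sell j) :=
        mul_lt_mul_of_pos_left (hS _ hj.1) (mul_pos hpos (M.endow_pos j))
      have h2 : lam j * M.endow j * (t * p (M.sell j)) ≤
          lam' j * M.endow j * (t * p (M.sell j)) :=
        mul_le_mul_of_nonneg_right (mul_le_mul_of_nonneg_right (hout j hj) (M.endow_pos j).le)
          (mul_pos ht (hp _)).le
      linarith
    exact ⟨le_antisymm (hz' ▸ hout j hj) (hl j), hz'⟩
  rcases hi with hi | hi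
  · exact hout_zero i hi
  · have hz : (∑ j : I, if M.sell j ∈ S ∧ M.buy j ∉ S then
        lam j * M.endow j * p (M.sell j) else 0) = 0 := by
      refine Finset.sum_eq_zero fun j _ => ?_
      split_ifs with hj
      · simp [(hout_zero j hj).1]
      · rfl
    rw [hz] at hbal
    have hnn : ∀ j ∈ Finset.univ, 0 ≤
        if M.sell j ∉ S ∧ M.buy j ∈ S then lam j * M.endow j * p (M.sell j) else 0 := by
      intro j _
      split_ifs
      · exact mul_nonneg (mul_nonneg (hl j) (M.endow_pos j).le) (hp _).le
      · exact le_rfl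
    have e := (Finset.sum_eq_zero_iff_of_nonneg hnn).1 hbal.symm i (Finset.mem_univ i)
    rw [if_pos hi] at e
    have hzi : lam i = 0 := by
      simpa [(M.endow_pos i).ne', (hp (M.sell i)).ne'] using e
    exact ⟨hzi, le_antisymm (hzi ▸ hin i hi) (hl' i)⟩

theorem tradeAmt_eq_zero {M : Market Asset I} {lam : I → ℝ} {C D : Asset}
    (h : ∀ i, M.sell i = C → M.buy i = D → lam i = 0) : tradeAmt M lam C D = 0 := by
  refine Finset.sum_eq_zero fun i _ => ?_
  split_ifs with hi
  · simp [h i hi.1 hi.2]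
  · rfl

/-- If the price of `A` rises by a larger factor than that of `B`, the assets whose price rises by
a larger factor than that of `B` do not trade with the others. -/
theorem IsEquilibrium.exists_partition_of_lt {M : Market Asset I} {p p' : Asset → ℝ}
    {lam lam' : I → ℝ} (h : IsEquilibrium M p lam) (h' : IsEquilibrium M p' lam')
    {A B : Asset} (hlt : p' B / p B < p' A / p A) :
    ∃ S : Set Asset, A ∈ S ∧ B ∉ S ∧ ∀ C ∈ S, ∀ D ∉ S,
      tradeAmt M lam C D = 0 ∧ tradeAmt M lam D C = 0 ∧
      tradeAmt M lam' C D = 0 ∧ tradeAmt M lam' D C = 0 := by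
  have hcut := fun i => h.fill_eq_zero_of_cut h' (div_pos (h'.1 B) (h.1 B))
    (S := {C | p' B / p B * p C < p' C}) (fun C hC => hC) (fun D hD => not_lt.1 hD) (i := i)
  refine ⟨{C | p' B / p B * p C < p' C}, (lt_div_iff₀ (h.1 A)).1 hlt, ?_, fun C hC D hD => ?_⟩
  · simp [div_mul_cancel₀ _ (h.1 B).ne']
  · refine ⟨tradeAmt_eq_zero fun i hs hb => ?_, tradeAmt_eq_zero fun i hs hb => ?_,
      tradeAmt_eq_zero fun i hs hb => ?_, tradeAmt_eq_zero fun i hs hb => ?_⟩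
    · exact (hcut i (.inl ⟨hs ▸ hC, hb ▸ hD⟩)).1
    · exact (hcut i (.inr ⟨hs ▸ hD, hb ▸ hC⟩)).1
    · exact (hcut i (.inl ⟨hs ▸ hC, hb ▸ hD⟩)).2
    · exact (hcut i (.inr ⟨hs ▸ hD, hb ▸ hC⟩)).2

/-- if two equilibria of the same market disagree on the relative
price of two assets `A` and `B`, then the assets can be partitioned into a set
`𝒜 ∋ A` and its complement `∋ B` with no trading activity across the partition
in either equilibrium. -/
theorem equilibria_price_disagreement_partition {Asset I : Type} [Fintype Asset]
    [Nonempty Asset] [Fintype I] (M : Market Asset I)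
    (p : Asset → ℝ) (lam : I → ℝ) (h : IsEquilibrium M p lam)
    (p' : Asset → ℝ) (lam' : I → ℝ) (h' : IsEquilibrium M p' lam')
    (A B : Asset) (hne : p A / p B ≠ p' A / p' B) :
    ∃ 𝒜 : Set Asset, A ∈ 𝒜 ∧ B ∉ 𝒜 ∧
      ∀ C ∈ 𝒜, ∀ D ∉ 𝒜,
        tradeAmt M lam C D = 0 ∧ tradeAmt M lam D C = 0 ∧
        tradeAmt M lam' C D = 0 ∧ tradeAmt M lam' D C = 0 := by
  have hr : p' B / p B ≠ p' A / p A := by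
    intro e
    apply hne
    rw [div_eq_div_iff (h.1 B).ne' (h.1 A).ne'] at e
    rw [div_eq_div_iff (h.1 B).ne' (h'.1 B).ne']
    linarith
  rcases lt_or_gt_of_ne hr with hlt | hlt
  · exact h.exists_partition_of_lt h' hlt
  · obtain ⟨S, hB, hA, hS⟩ := h.exists_partition_of_lt h' hlt
    refine ⟨Sᶜ, hA, not_not_intro hB, fun C hC D hD => ?_⟩
    obtain ⟨h1, h2, h3, h4⟩ := hS D (not_not.1 hD) C hC
    exact ⟨h2, h1, h4, h3⟩
end

section
/- Let a linear exchange market with limit sell offers have its asset set partitioned into a set 𝒜 of pricing assets and a set ℬ of stocks, with a map a : ℬ → 𝒜, such that every offer either trades between two pricing assets (S_i, B_i ∈ 𝒜) or trades between a stock s and its pricing asset a(s) (i.e., {S_i, B_i} = {s, a(s)}). Suppose (p, λ) is an equilibrium of the restricted market consisting only of the pricing assets and the offers among them, and for each stock s ∈ ℬ, (r^s, μ^s) is an equilibrium of the restricted market consisting only of the two assets s and a(s) and the offers between them. Then defining prices p' by p'_a = p_a for a ∈ 𝒜 and p'_s = (r^s_s / r^s_{a(s)}) · p_{a(s)} for s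 ∈ ℬ, and fill fractions λ' that agree with λ on offers among pricing assets and with μ^s on offers between s and a(s), the pair (p', λ') is an equilibrium of the entire market. -/
attribute [local instance] Classical.propDecidable

variable {Asset I : Type} [Fintype Asset] [Fintype I]

/-- Equilibrium of the restricted market consisting of the subset `V` of assets
together with the subfamily `O` of offers (whose sold and bought assets lie in
`V`): prices are positive on `V`, fill fractions of offers in `O` lie in
`[0,1]` and respect limit prices, and each asset of `V` has its amount sold by
offers in `O` equal to its amount bought by offers in `O`. -/
def IsRestrictedEquilibrium (M : Market Asset I) (V : Set Asset) (O : Set I)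
    (p : Asset → ℝ) (lam : I → ℝ) : Prop :=
  (∀ A ∈ V, 0 < p A) ∧
  (∀ i ∈ O, lam i ∈ Set.Icc (0:ℝ) 1) ∧
  (∀ i ∈ O, M.limit i * p (M.buy i) < p (M.sell i) → lam i = 1) ∧
  (∀ i ∈ O, p (M.sell i) < M.limit i * p (M.buy i) → lam i = 0) ∧
  (∀ A ∈ V, (∑ i : I, if M.sell i = A ∧ i ∈ O then lam i * M.endow i else 0) =
        (∑ i : I, if M.buy i = A ∧ i ∈ O then
            lam i * M.endow i * p (M.sell i) / p (M.buy i) else 0))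

/-- The set of assets appearing (as sold or bought asset) in a subfamily `O` of
offers. -/
def assetSet (M : Market Asset I) (O : Set I) : Set Asset :=
  {A | ∃ i ∈ O, M.sell i = A ∨ M.buy i = A}

/-- Restricted equilibria are invariant under rescaling the prices by a positive constant, and
depend only on the prices in `V` and the fill fractions in `O`. -/
theorem IsRestrictedEquilibrium.rescale {M : Market Asset I} {V : Set Asset} {O : Set I}
    {p q : Asset → ℝ} {lam mu : I → ℝ} (h : IsRestrictedEquilibrium M V O p lam)
    (hO : ∀ i ∈ O, M.sell i ∈ V ∧ M.buy i ∈ V) {c : ℝ} (hc : 0 < c)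
    (hq : ∀ A ∈ V, q A = c * p A) (hmu : ∀ i ∈ O, mu i = lam i) :
    IsRestrictedEquilibrium M V O q mu := by
  obtain ⟨hpos, hIcc, hone, hzero, hbal⟩ := h
  refine ⟨fun A hA => ?_, fun i hi => ?_, fun i hi hlt => ?_, fun i hi hlt => ?_, fun A hA => ?_⟩
  · rw [hq A hA]
    exact mul_pos hc (hpos A hA)
  · rw [hmu i hi]
    exact hIcc i hi
  · rw [hq _ (hO i hi).1, hq _ (hO i hi).2, mul_left_comm] at hlt
    rw [hmu i hi]
    exact hone i hi (lt_of_mul_lt_mul_left hlt hc.le)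
  · rw [hq _ (hO i hi).1, hq _ (hO i hi).2, mul_left_comm (M.limit i)] at hlt
    rw [hmu i hi]
    exact hzero i hi (lt_of_mul_lt_mul_left hlt hc.le)
  · refine Eq.trans (Finset.sum_congr rfl fun i _ => ?_)
      ((hbal A hA).trans (Finset.sum_congr rfl fun i _ => ?_))
    · split_ifs with hi
      · rw [hmu i hi.2]
      · rfl
    · split_ifs with hi
      · rw [hmu i hi.2, hq _ (hO i hi.2).1, hq _ (hO i hi.2).2, mul_left_comm,
          mul_div_mul_left _ _ hc.ne']
      · rfl

theorem sum_ite_eq_sum_blocks {K : Type*} [Fintype K] {O : K → Set I}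
    (hO : ∀ i, ∃! k, i ∈ O k) (Q : I → Prop) (f : I → ℝ) :
    (∑ i, if Q i then f i else 0) = ∑ k, ∑ i, if Q i ∧ i ∈ O k then f i else 0 := by
  rw [Finset.sum_comm]
  refine Finset.sum_congr rfl fun i _ => ?_
  obtain ⟨k, hk, huniq⟩ := hO i
  rw [Finset.sum_eq_single k]
  · simp only [hk, and_true]
  · exact fun l _ hl => if_neg fun h => hl (huniq l h.2)
  · exact fun h => absurd (Finset.mem_univ k) h

/-- If the offers are partitioned into blocks, and `(p, lam)` is an equilibrium of every block,
then it is an equilibrium of the entire market. -/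
theorem IsEquilibrium.of_blocks {K : Type*} [Fintype K] {M : Market Asset I}
    {V : K → Set Asset} {O : K → Set I} {p : Asset → ℝ} {lam : I → ℝ}
    (hV : ∀ A, ∃ k, A ∈ V k) (hO : ∀ i, ∃! k, i ∈ O k)
    (hOV : ∀ k, ∀ i ∈ O k, M.sell i ∈ V k ∧ M.buy i ∈ V k)
    (h : ∀ k, IsRestrictedEquilibrium M (V k) (O k) p lam) : IsEquilibrium M p lam := by
  refine ⟨fun A => ?_, fun i => ?_, fun i => ?_, fun i => ?_, fun A => ?_⟩
  · obtain ⟨k, hk⟩ := hV A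
    exact (h k).1 A hk
  · obtain ⟨k, hk, -⟩ := hO i
    exact (h k).2.1 i hk
  · obtain ⟨k, hk, -⟩ := hO i
    exact (h k).2.2.1 i hk
  · obtain ⟨k, hk, -⟩ := hO i
    exact (h k).2.2.2.1 i hk
  · rw [sum_ite_eq_sum_blocks hO, sum_ite_eq_sum_blocks hO]
    refine Finset.sum_congr rfl fun k _ => ?_
    by_cases hA : A ∈ V k
    · exact (h k).2.2.2.2 A hA
    · rw [Finset.sum_eq_zero, Finset.sum_eq_zero]
      · exact fun i _ => if_neg fun hi : M.buy i = A ∧ i ∈ O k => hA (hi.1 ▸ (hOV k i hi.2).2)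
      · exact fun i _ => if_neg fun hi : M.sell i = A ∧ i ∈ O k => hA (hi.1 ▸ (hOV k i hi.2).1)

/-- decomposition between pricing assets and stocks.  If every
offer either trades between two pricing assets (members of `𝒜`), or between a
stock `s ∉ 𝒜` and its pricing asset `a s ∈ 𝒜`, then an equilibrium `(p, lam)`
of the restricted market on the pricing assets, combined with equilibria
`(r s, mu s)` of each two-asset restricted market `{s, a s}`, yields an
equilibrium of the entire market, with stock prices
`p'_s = (r^s_s / r^s_{a s}) · p_{a s}`. -/
theorem pricing_asset_stock_decomposition {Asset I : Type} [Fintype Asset]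
    [Nonempty Asset] [Fintype I] (M : Market Asset I)
    (𝒜 : Set Asset) (a : Asset → Asset)
    (ha : ∀ s ∉ 𝒜, a s ∈ 𝒜)
    (hoffers : ∀ i, (M.sell i ∈ 𝒜 ∧ M.buy i ∈ 𝒜) ∨
      (M.sell i ∉ 𝒜 ∧ M.buy i = a (M.sell i)) ∨
      (M.buy i ∉ 𝒜 ∧ M.sell i = a (M.buy i)))
    (p : Asset → ℝ) (lam : I → ℝ)
    (hp : IsRestrictedEquilibrium M 𝒜 {i | M.sell i ∈ 𝒜 ∧ M.buy i ∈ 𝒜} p lam)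
    (r : Asset → Asset → ℝ) (mu : Asset → I → ℝ)
    (hr : ∀ s ∉ 𝒜, IsRestrictedEquilibrium M {s, a s}
      {i | (M.sell i = s ∧ M.buy i = a s) ∨ (M.sell i = a s ∧ M.buy i = s)}
      (r s) (mu s)) :
    IsEquilibrium M
      (fun A => if A ∈ 𝒜 then p A else (r A A / r A (a A)) * p (a A))
      (fun i => if M.sell i ∈ 𝒜 ∧ M.buy i ∈ 𝒜 then lam i
                else if M.sell i ∉ 𝒜 then mu (M.sell i) i else mu (M.buy i) i) := by
  let V : Option {s // s ∉ 𝒜} → Set Asset := fun k => k.elim 𝒜 fun s => {s.1, a s}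
  let O : Option {s // s ∉ 𝒜} → Set I := fun k =>
    k.elim {i | M.sell i ∈ 𝒜 ∧ M.buy i ∈ 𝒜} fun s =>
      {i | (M.sell i = s ∧ M.buy i = a s) ∨ (M.sell i = a s ∧ M.buy i = s)}
  have hOV : ∀ k, ∀ i ∈ O k, M.sell i ∈ V k ∧ M.buy i ∈ V k := by
    rintro (_ | s) i hi
    · exact hi
    · rcases hi with ⟨h₁, h₂⟩ | ⟨h₁, h₂⟩
      · exact ⟨Or.inl h₁, Or.inr h₂⟩
      · exact ⟨Or.inr h₁, Or.inl h₂⟩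
  refine IsEquilibrium.of_blocks (V := V) (O := O) (fun A => ?_) (fun i => ?_) hOV ?_
  · by_cases hA : A ∈ 𝒜
    · exact ⟨none, hA⟩
    · exact ⟨some ⟨A, hA⟩, Or.inl rfl⟩
  · rcases hoffers i with hi | ⟨hs, hb⟩ | ⟨hb, hs⟩
    · refine ⟨none, hi, ?_⟩
      rintro (_ | ⟨t, ht⟩) h
      · rfl
      · rcases h with ⟨(h : M.sell i = t), -⟩ | ⟨-, (h : M.buy i = t)⟩
        · exact absurd (h ▸ hi.1) ht
        · exact absurd (h ▸ hi.2) ht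
    · refine ⟨some ⟨_, hs⟩, Or.inl ⟨rfl, hb⟩, ?_⟩
      rintro (_ | ⟨t, ht⟩) h
      · exact absurd h.1 hs
      · rcases h with ⟨h, -⟩ | ⟨h, -⟩
        · exact congrArg some (Subtype.ext h.symm)
        · exact absurd (h ▸ ha t ht) hs
    · refine ⟨some ⟨_, hb⟩, Or.inr ⟨hs, rfl⟩, ?_⟩
      rintro (_ | ⟨t, ht⟩) h
      · exact absurd h.2 hb
      · rcases h with ⟨-, h⟩ | ⟨-, h⟩
        · exact absurd (h ▸ ha t ht) hb
        · exact congrArg some (Subtype.ext h.symm)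
  · rintro (_ | ⟨s, hs⟩)
    · refine hp.rescale (hOV none) one_pos (fun A hA => ?_) (fun i hi => if_pos hi)
      rw [if_pos hA, one_mul]
    · have has := ha s hs
      have hrpos : 0 < r s (a s) := (hr s hs).1 _ (Or.inr rfl)
      refine (hr s hs).rescale (hOV (some ⟨s, hs⟩)) (div_pos (hp.1 _ has) hrpos) ?_ ?_
      · rintro A (rfl | rfl)
        · rw [if_neg hs]
          ring
        · rw [if_pos has, div_mul_cancel₀ _ hrpos.ne']
      · rintro i (⟨h₁, h₂⟩ | ⟨h₁, h₂⟩)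
        · simp [h₁, hs]
        · simp [h₁, h₂, hs, has]
end

section
/- Let (p, λ) and (p', λ') be two equilibria of the same linear exchange market with limit sell offers, and let c ≠ d be assets with p_c / p_d < p'_c / p'_d. Then (p_c / p_d) · x_{cd} ≤ (p'_c / p'_d) · x'_{cd} and x_{dc} ≥ x'_{dc}, where x_{AB} = Σ_{i : S_i = A, B_i = B} λ_i e_i and x'_{AB} = Σ_{i : S_i = A, B_i = B} λ'_i e_i. -/
attribute [local instance] Classical.propDecidable

variable {Asset I : Type} [Fintype Asset] [Fintype I]

theorem IsEquilibrium.tradeAmt_le_tradeAmt_of_rate_lt {M : Market Asset I}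
    {p p' : Asset → ℝ} {lam lam' : I → ℝ}
    (h : IsEquilibrium M p lam) (h' : IsEquilibrium M p' lam') {a b : Asset}
    (hrate : p a / p b < p' a / p' b) :
    tradeAmt M lam a b ≤ tradeAmt M lam' a b := by
  obtain ⟨hp, hl, -, hzero, -⟩ := h
  obtain ⟨hp', hl', hone, -, -⟩ := h'
  refine Finset.sum_le_sum fun i _ => ?_
  split_ifs with hi
  · obtain ⟨rfl, rfl⟩ := hi
    refine mul_le_mul_of_nonneg_right ?_ (M.endow_pos i).le
    rcases lt_or_ge (p (M.sell i)) (M.limit i * p (M.buy i)) with hlt | hge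
    · rw [hzero i hlt]
      exact (hl' i).1
    · rw [hone i ((lt_div_iff₀ (hp' _)).1 (((le_div_iff₀ (hp _)).2 hge).trans_lt hrate))]
      exact (hl i).2
  · exact le_rfl

theorem IsEquilibrium.tradeAmt_nonneg {M : Market Asset I} {p : Asset → ℝ} {lam : I → ℝ}
    (h : IsEquilibrium M p lam) (a b : Asset) : 0 ≤ tradeAmt M lam a b := by
  refine Finset.sum_nonneg fun i _ => ?_
  split_ifs
  · exact mul_nonneg (h.2.1 i).1 (M.endow_pos i).le
  · exact le_rfl

/-- if two equilibria have `p_c / p_d < p'_c / p'_d` for assets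
`c ≠ d`, then the price-weighted amount of `c` sold for `d` is no larger in the
first equilibrium, and the amount of `d` sold for `c` is no smaller. -/
theorem trade_monotone_in_rate {Asset I : Type} [Fintype Asset] [Nonempty Asset]
    [Fintype I] (M : Market Asset I)
    (p : Asset → ℝ) (lam : I → ℝ) (h : IsEquilibrium M p lam)
    (p' : Asset → ℝ) (lam' : I → ℝ) (h' : IsEquilibrium M p' lam')
    (c d : Asset) (hcd : c ≠ d)
    (hrate : p c / p d < p' c / p' d) :
    (p c / p d) * tradeAmt M lam c d ≤ (p' c / p' d) * tradeAmt M lam' c d ∧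
    tradeAmt M lam' d c ≤ tradeAmt M lam d c := by
  have hinv : p' d / p' c < p d / p c := by
    rw [← inv_div (p c) (p d), ← inv_div (p' c) (p' d)]
    exact inv_strictAnti₀ (div_pos (h.1 c) (h.1 d)) hrate
  exact ⟨mul_le_mul hrate.le (h.tradeAmt_le_tradeAmt_of_rate_lt h' hrate)
    (h.tradeAmt_nonneg c d) (div_pos (h'.1 c) (h'.1 d)).le,
    h'.tradeAmt_le_tradeAmt_of_rate_lt h hinv⟩
end
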